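/- For the Jordan derivation D_n = (1 − x_1x_2) ∂/∂x_1 + x_1^3 ∂/∂x_2 + Σ_{i=3}^n x_{i-1} ∂/∂x_i of k[x_1,...,x_n] (n ≥ 2), the image of D_n intersects the constants k only in 0; in particular D_n admits no polynomial s with D_n(s) = 1. -/

import Mathlib

open MvPolynomial

/-- `x` is a positive rational multiple of `c`. -/
def IsPosRatMul {K : Type*} [Field K] (c x : K) : Prop := ∃ q : ℚ, 0 < q ∧ x = q * c

namespace IsPosRatMul

variable {K : Type*} [Field K] {c x y : K}

lemma refl (c : K) : IsPosRatMul c c := ⟨1, one_pos, by simp⟩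

lemma eq_zero_of_left (h : IsPosRatMul 0 x) : x = 0 := by
  obtain ⟨p, hp, h⟩ := h
  simpa using h

variable [CharZero K]

lemma add (hx : IsPosRatMul c x) (hy : IsPosRatMul c y) : IsPosRatMul c (x + y) := by
  obtain ⟨p, hp, rfl⟩ := hx
  obtain ⟨q, hq, rfl⟩ := hy
  exact ⟨p + q, by positivity, by push_cast; ring⟩

lemma natCast_mul (hx : IsPosRatMul c x) {n : ℕ} (hn : n ≠ 0) : IsPosRatMul c (n * x) := by
  obtain ⟨p, hp, rfl⟩ := hx
  exact ⟨n * p, by positivity, by push_cast; ring⟩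

lemma of_natCast_mul {n : ℕ} (hn : n ≠ 0) (hx : IsPosRatMul c (n * x)) : IsPosRatMul c x := by
  obtain ⟨p, hp, h⟩ := hx
  have hn' : (n : K) ≠ 0 := Nat.cast_ne_zero.2 hn
  refine ⟨p / n, by positivity, mul_left_cancel₀ hn' ?_⟩
  rw [h]
  push_cast
  field_simp

lemma eq_zero_of_zero (h : IsPosRatMul c 0) : c = 0 := by
  obtain ⟨p, hp, h⟩ := h
  simpa [hp.ne'] using h.symm

end IsPosRatMul

section Coefficients

variable {K : Type*} [Field K] [CharZero K] {a b : ℕ → ℕ → K}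

/-- The relation between the coefficients `a` of `f` and the coefficients `b` of
`(1 - x y) ∂f/∂x + x³ ∂f/∂y`. -/
def JordanRecurrence (a b : ℕ → ℕ → K) : Prop :=
  ∀ p q : ℕ, ((p + 1 : ℕ) : K) * a (p + 1) q - (if q = 0 then 0 else p * a p (q - 1)) +
    (if p < 3 then 0 else ((q + 1 : ℕ) : K) * a (p - 3) (q + 1)) = b p q

/-- Coefficients in the top degree for the weights `2, 3` vanish. -/
lemma JordanRecurrence.eq_zero_of_top (h : JordanRecurrence a b)
    (hb : ∀ p q, b p q ≠ 0 → p = 0 ∧ q ≤ 1) {N : ℕ} (hN : N ≠ 0)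
    (htop : ∀ i j, N < 2 * i + 3 * j → a i j = 0) {i j : ℕ} (hij : 2 * i + 3 * j = N) :
    a i j = 0 := by
  have hb0 : ∀ p q, ¬ (p = 0 ∧ q ≤ 1) → b p q = 0 := fun p q hpq =>
    by_contra fun hne => hpq (hb p q hne)
  have hstep : ∀ i j, 2 * (i + 3) + 3 * j = N →
      ((i + 3 : ℕ) : K) * a (i + 3) j = ((j + 2 : ℕ) : K) * a i (j + 2) := by
    intro i j hij
    have := h (i + 3) (j + 1)
    rw [hb0 _ _ (by omega), htop (i + 3 + 1) (j + 1) (by omega)] at this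
    simp only [Nat.add_sub_cancel, if_neg (show ¬ j + 1 = 0 by omega),
      if_neg (show ¬ i + 3 < 3 by omega)] at this
    linear_combination -this
  have hsmall : ∀ i j, 0 < i → i < 3 → 2 * i + 3 * j = N → a i j = 0 := by
    intro i j h0 h3 hij
    have := h i (j + 1)
    rw [hb0 _ _ (by omega), htop (i + 1) (j + 1) (by omega)] at this
    simpa [h3, h0.ne'] using this
  have hone : ∀ i, 2 * i + 3 = N → a i 1 = 0 := by
    intro i hi
    have := h (i + 3) 0
    rw [hb0 _ _ (by omega), htop (i + 3 + 1) 0 (by omega)] at this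
    simpa using this
  have hnot : ∀ r i j, 0 < i → i < 3 → 2 * (3 * r + i) + 3 * j = N → a (3 * r + i) j = 0 := by
    intro r
    induction r with
    | zero => intro i j h0 h3 hij; simpa using hsmall i j h0 h3 (by omega)
    | succ r ih =>
      intro i j h0 h3 hij
      have := hstep (3 * r + i) j (by omega)
      rw [ih i (j + 2) h0 h3 (by omega)] at this
      rw [show 3 * (r + 1) + i = 3 * r + i + 3 by ring]
      rw [mul_zero] at this
      exact (mul_eq_zero.1 this).resolve_left (Nat.cast_ne_zero.2 (by omega))
  have hmul : ∀ r j, 2 * (3 * r) + 3 * j = N → IsPosRatMul (a 0 (2 * r + j)) (a (3 * r) j) := by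
    intro r
    induction r with
    | zero => intro j _; simpa using IsPosRatMul.refl _
    | succ r ih =>
      intro j hij
      have h1 := ih (j + 2) (by omega)
      rw [show 2 * (r + 1) + j = 2 * r + (j + 2) by ring, show 3 * (r + 1) = 3 * r + 3 by ring]
      refine IsPosRatMul.of_natCast_mul (n := 3 * r + 3) (by omega) ?_
      rw [hstep (3 * r) j (by omega)]
      exact h1.natCast_mul (by omega)
  have hzero : ∀ J, 3 * J = N → a 0 J = 0 := by
    intro J hJ
    obtain ⟨m, rfl | rfl⟩ := Nat.even_or_odd' J
    · have hF : ∀ r s, r + s = m → IsPosRatMul (a 0 (2 * m)) (a (3 * r) (2 * s)) := by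
        rintro r s rfl
        rw [mul_add]
        exact hmul r (2 * s) (by omega)
      have hG : ∀ t s, t + s + 2 = m →
          IsPosRatMul (a 0 (2 * m)) (a (3 * t + 2) (2 * s + 1)) := by
        intro t
        induction t with
        | zero =>
          intro s hs
          have h1 := h 2 (2 * s + 2)
          have h2 := hF 1 (s + 1) (by omega)
          rw [hb0 _ _ (by omega)] at h1
          simp only [show 2 * s + 2 - 1 = 2 * s + 1 by omega, if_pos (show 2 < 3 by omega),
            if_neg (show ¬ 2 * s + 2 = 0 by omega)] at h1
          refine IsPosRatMul.of_natCast_mul (n := 2) (by omega) ?_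
          have h3 := h2.natCast_mul (n := 3) (by omega)
          convert h3 using 1
          linear_combination -h1
        | succ t ih =>
          intro s hs
          have h1 := h (3 * t + 5) (2 * s + 2)
          have h2 := hF (t + 2) (s + 1) (by omega)
          rw [hb0 _ _ (by omega)] at h1
          simp only [show 2 * s + 2 - 1 = 2 * s + 1 by omega,
            show 3 * t + 5 - 3 = 3 * t + 2 by omega, if_neg (show ¬ 3 * t + 5 < 3 by omega),
            if_neg (show ¬ 2 * s + 2 = 0 by omega)] at h1
          rw [show 3 * (t + 1) + 2 = 3 * t + 5 by ring]
          refine IsPosRatMul.of_natCast_mul (n := 3 * t + 5) (by omega) ?_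
          have h3 := (h2.natCast_mul (n := 3 * t + 5 + 1) (by omega)).add
            ((ih (s + 1) (by omega)).natCast_mul (n := 2 * s + 2 + 1) (by omega))
          convert h3 using 1
          rw [show 3 * (t + 2) = 3 * t + 5 + 1 by ring,
            show 2 * (s + 1) + 1 = 2 * s + 2 + 1 by ring, show 2 * (s + 1) = 2 * s + 2 by ring]
          linear_combination -h1
      obtain _ | _ | t := m
      · omega
      · have h1 := h 2 0
        rw [hb0 _ _ (by omega)] at h1
        have h2 : a 3 0 = 0 := by
          have h4 : ((2 + 1 : ℕ) : K) * a 3 0 = 0 := by simpa using h1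
          exact (mul_eq_zero.1 h4).resolve_left (Nat.cast_ne_zero.2 (by omega))
        have h3 := hF 1 0 (by omega)
        simp only [mul_one, mul_zero, h2] at h3
        exact h3.eq_zero_of_zero
      · have h1 := h (3 * t + 5) 0
        rw [hb0 _ _ (by omega)] at h1
        have h3 := ((hF (t + 2) 0 (by omega)).natCast_mul (n := 3 * t + 5 + 1) (by omega)).add
            ((hG t 0 (by omega)).natCast_mul (n := 0 + 1) (by omega))
        simp only [show 3 * t + 5 - 3 = 3 * t + 2 by omega, if_neg (show ¬ 3 * t + 5 < 3 by omega),
          if_true, sub_zero] at h1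
        rw [show 3 * (t + 2) = 3 * t + 5 + 1 by ring, mul_zero, h1] at h3
        exact h3.eq_zero_of_zero
    · have h1 := hmul m 1 (by omega)
      rw [hone _ (by omega)] at h1
      exact h1.eq_zero_of_zero
  obtain h0 | h0 := Nat.eq_zero_or_pos (i % 3)
  · have h1 := hmul (i / 3) j (by omega)
    rw [hzero _ (by omega), show 3 * (i / 3) = i by omega] at h1
    exact h1.eq_zero_of_left
  · have h1 := hnot (i / 3) (i % 3) j h0 (by omega) (by omega)
    rwa [Nat.div_add_mod] at h1

lemma JordanRecurrence.eq_zero (h : JordanRecurrence a b)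
    (hb : ∀ p q, b p q ≠ 0 → p = 0 ∧ q ≤ 1) {B : ℕ}
    (hB : ∀ i j, B < 2 * i + 3 * j → a i j = 0) {i j : ℕ} (hij : 0 < 2 * i + 3 * j) :
    a i j = 0 := by
  induction B with
  | zero => exact hB i j hij
  | succ B ih =>
    refine ih fun i j hlt => ?_
    obtain heq | hlt := (Nat.succ_le_of_lt hlt).eq_or_lt
    · exact h.eq_zero_of_top hb B.succ_ne_zero hB heq.symm
    · exact hB i j hlt

end Coefficients

/-- The elements `1` and `u` are linearly independent, and their span meets the image of `D` only
in `0`; moreover every element of `R` killed by `D` comes from `k`. -/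
def SpanAvoidsRange {k R : Type*} [Field k] [CommRing R] [Algebra k R] (D : Derivation k R R)
    (u : R) : Prop :=
  ∀ (f : R) (c a : k), D f = algebraMap k R c + a • u →
    (∃ c', f = algebraMap k R c') ∧ c = 0 ∧ a = 0

lemma Derivation.coeff_apply_polynomial {k R : Type*} [Field k] [CommRing R] [Algebra k R]
    (D : Derivation k R R) (u : R) (Δ : Derivation k (Polynomial R) (Polynomial R))
    (hC : ∀ r, Δ (Polynomial.C r) = Polynomial.C (D r)) (hX : Δ Polynomial.X = Polynomial.C u)
    (f : Polynomial R) (i : ℕ) :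
    (Δ f).coeff i = D (f.coeff i) + ((i + 1 : ℕ) : R) * (u * f.coeff (i + 1)) := by
  induction f using Polynomial.induction_on' with
  | add p q hp hq => simp only [map_add, Polynomial.coeff_add, hp, hq]; ring
  | monomial n r =>
    have hmon : Δ (Polynomial.monomial n r) =
        Polynomial.C (D r) * Polynomial.X ^ n + Polynomial.C (r * n * u) * Polynomial.X ^ (n - 1) := by
      rw [← Polynomial.C_mul_X_pow_eq_monomial, Derivation.leibniz, Derivation.leibniz_pow, hC, hX]
      simp only [smul_eq_mul, nsmul_eq_mul, map_mul, Polynomial.C_eq_natCast]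
      ring
    rw [hmon]
    simp only [Polynomial.coeff_add, Polynomial.coeff_C_mul_X_pow, Polynomial.coeff_monomial]
    congr 1
    · simp only [eq_comm (a := i)]
      split_ifs <;> simp
    · obtain _ | n := n
      · simp
      · simp only [Nat.add_sub_cancel, add_left_inj, eq_comm (a := i)]
        split_ifs with hn
        · subst hn; ring
        · simp

lemma SpanAvoidsRange.polynomial {k R : Type*} [Field k] [CharZero k] [CommRing R] [Nontrivial R]
    [Algebra k R] {D : Derivation k R R} {u : R} (h : SpanAvoidsRange D u)
    (Δ : Derivation k (Polynomial R) (Polynomial R))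
    (hC : ∀ r, Δ (Polynomial.C r) = Polynomial.C (D r)) (hX : Δ Polynomial.X = Polynomial.C u) :
    SpanAvoidsRange Δ Polynomial.X := by
  intro f c a hf
  have hcoeff := fun i => D.coeff_apply_polynomial u Δ hC hX f i
  rw [hf] at hcoeff
  have hconst : ∀ i, ∃ γ : k, (algebraMap k (Polynomial R) c + a • Polynomial.X).coeff i =
      algebraMap k R γ := by
    intro i
    refine ⟨(if i = 0 then c else 0) + (if i = 1 then a else 0), ?_⟩
    rw [Polynomial.algebraMap_apply]
    simp only [Polynomial.coeff_add, Polynomial.coeff_C, Polynomial.coeff_smul, Polynomial.coeff_X,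
      eq_comm (a := 1), map_add]
    split_ifs <;> simp [Algebra.smul_def]
  have hdeg : f.natDegree = 0 := by
    by_contra hd
    obtain ⟨d, hd⟩ := Nat.exists_eq_succ_of_ne_zero hd
    have htop := hcoeff (d + 1)
    rw [Polynomial.coeff_eq_zero_of_natDegree_lt (n := d + 1 + 1) (by omega)] at htop
    obtain ⟨γ, hγ⟩ := hconst (d + 1)
    obtain ⟨⟨α, hα⟩, -, -⟩ := h (f.coeff (d + 1)) γ 0 (by rw [← hγ, htop]; simp)
    obtain ⟨δ, hδ⟩ := hconst d
    have hnext := hcoeff d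
    rw [hδ, hα] at hnext
    obtain ⟨-, -, h0⟩ := h (f.coeff d) δ (-((d + 1 : ℕ) * α)) (by
      rw [hnext, Algebra.smul_def]
      simp only [map_neg, map_mul, map_natCast]
      ring)
    have hα0 : α = 0 := by
      rw [neg_eq_zero] at h0
      exact (mul_eq_zero.1 h0).resolve_left (Nat.cast_ne_zero.2 (by omega))
    have : f.leadingCoeff = 0 := by
      rw [Polynomial.leadingCoeff, hd, Nat.succ_eq_add_one, hα, hα0, map_zero]
    rw [Polynomial.leadingCoeff_eq_zero] at this
    simp [this] at hd
  rw [Polynomial.eq_C_of_natDegree_eq_zero hdeg] at hcoeff ⊢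
  have h1 := hcoeff 1
  have h0 := hcoeff 0
  rw [Polynomial.algebraMap_apply] at h0 h1
  simp [Polynomial.coeff_C, Polynomial.coeff_X] at h0 h1
  obtain ⟨⟨c', hc'⟩, hc, -⟩ := h (f.coeff 0) c 0 (by rw [← h0]; simp)
  exact ⟨⟨c', by rw [hc', Polynomial.algebraMap_apply]⟩, hc, h1⟩

/-- Transport of a derivation along an algebra isomorphism. -/
noncomputable def Derivation.conjAlgEquiv {k A B : Type*} [Field k] [CommRing A] [CommRing B]
    [Algebra k A] [Algebra k B] (e : A ≃ₐ[k] B) (D : Derivation k A A) : Derivation k B B :=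
  Derivation.mk' (e.toLinearMap ∘ₗ D.toLinearMap ∘ₗ e.symm.toLinearMap) fun x y => by simp

lemma Derivation.conjAlgEquiv_apply {k A B : Type*} [Field k] [CommRing A] [CommRing B]
    [Algebra k A] [Algebra k B] (e : A ≃ₐ[k] B) (D : Derivation k A A) (x : A) :
    D.conjAlgEquiv e (e x) = e (D x) := by
  change e (D (e.symm (e x))) = e (D x)
  rw [e.symm_apply_apply]

lemma SpanAvoidsRange.of_conjAlgEquiv {k A B : Type*} [Field k] [CommRing A] [CommRing B]
    [Algebra k A] [Algebra k B] (e : A ≃ₐ[k] B) {D : Derivation k A A} {u : A}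
    (h : SpanAvoidsRange (D.conjAlgEquiv e) (e u)) : SpanAvoidsRange D u := by
  intro f c a hf
  obtain ⟨⟨c', hc'⟩, h⟩ := h (e f) c a (by rw [D.conjAlgEquiv_apply, hf]; simp)
  exact ⟨⟨c', e.injective (by rw [hc', AlgEquiv.commutes])⟩, h⟩

section PlaneCoefficients

/-- The exponent of `X 0 ^ i * X 1 ^ j`. -/
noncomputable def planeExponent (i j : ℕ) : Fin 2 →₀ ℕ := Finsupp.single 0 i + Finsupp.single 1 j

@[simp] lemma planeExponent_apply_zero (i j : ℕ) : planeExponent i j 0 = i := by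
  simp [planeExponent]

@[simp] lemma planeExponent_apply_one (i j : ℕ) : planeExponent i j 1 = j := by
  simp [planeExponent]

lemma planeExponent_eq (m : Fin 2 →₀ ℕ) : planeExponent (m 0) (m 1) = m := by
  ext i; fin_cases i <;> simp

lemma planeExponent_le_iff {i j p q : ℕ} :
    planeExponent i j ≤ planeExponent p q ↔ i ≤ p ∧ j ≤ q := by
  simp [Finsupp.le_def, Fin.forall_fin_two]

lemma planeExponent_sub (i j p q : ℕ) :
    planeExponent i j - planeExponent p q = planeExponent (i - p) (j - q) := by
  ext l; fin_cases l <;> simp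

lemma planeExponent_add_single_zero (i j : ℕ) :
    planeExponent i j + Finsupp.single 0 1 = planeExponent (i + 1) j := by
  ext l; fin_cases l <;> simp

lemma planeExponent_add_single_one (i j : ℕ) :
    planeExponent i j + Finsupp.single 1 1 = planeExponent i (j + 1) := by
  ext l; fin_cases l <;> simp

variable {k : Type*} [Field k]

lemma jordanRecurrence_coeff {D : Derivation k (MvPolynomial (Fin 2) k) (MvPolynomial (Fin 2) k)}
    (h0 : D (X 0) = 1 - X 0 * X 1) (h1 : D (X 1) = X 0 ^ 3) (f : MvPolynomial (Fin 2) k) :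
    JordanRecurrence (fun i j => coeff (planeExponent i j) f)
      (fun i j => coeff (planeExponent i j) (D f)) := by
  have hD : D = (1 - X 0 * X 1 : MvPolynomial (Fin 2) k) • pderiv 0 +
      (X 0 ^ 3 : MvPolynomial (Fin 2) k) • pderiv 1 := by
    refine derivation_ext fun i => ?_
    fin_cases i <;> simp [h0, h1, pderiv_X]
  have hXY : (X 0 * X 1 : MvPolynomial (Fin 2) k) = monomial (planeExponent 1 1) 1 := by
    simp [X, monomial_mul, planeExponent]
  have hXXX : (X 0 ^ 3 : MvPolynomial (Fin 2) k) = monomial (planeExponent 3 0) 1 := by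
    simp [X_pow_eq_monomial, planeExponent]
  intro p q
  simp only [hD, hXY, hXXX, Derivation.add_apply, Derivation.smul_apply, smul_eq_mul, sub_mul,
    one_mul, coeff_add, coeff_sub, coeff_monomial_mul', planeExponent_le_iff, planeExponent_sub,
    coeff_pderiv, planeExponent_add_single_zero, planeExponent_add_single_one,
    planeExponent_apply_zero, planeExponent_apply_one]
  obtain _ | p := p <;> obtain _ | q := q <;> simp <;> split_ifs <;> first | (exfalso; omega) | ring

lemma spanAvoidsRange_plane [CharZero k]
    {D : Derivation k (MvPolynomial (Fin 2) k) (MvPolynomial (Fin 2) k)}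
    (h0 : D (X 0) = 1 - X 0 * X 1) (h1 : D (X 1) = X 0 ^ 3) : SpanAvoidsRange D (X 1) := by
  intro f c a hf
  have hrec := jordanRecurrence_coeff h0 h1 f
  have hvanish : ∀ i j, 0 < 2 * i + 3 * j → coeff (planeExponent i j) f = 0 := by
    intro i j hij
    refine hrec.eq_zero ?_ (B := f.support.sup fun m => 2 * m 0 + 3 * m 1) ?_ hij
    · intro p q hpq
      by_contra hne
      refine hpq ?_
      have hp : planeExponent p q ≠ 0 := fun h => hne
        ⟨by simpa using DFunLike.congr_fun h 0, by simpa using (DFunLike.congr_fun h 1).trans_le⟩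
      have hq : planeExponent p q ≠ Finsupp.single 1 1 := fun h => hne
        ⟨by simpa using DFunLike.congr_fun h 0, by simpa using (DFunLike.congr_fun h 1).le⟩
      simp [hf, algebraMap_eq, coeff_C, coeff_X, hp.symm, hq.symm]
    · intro i j hlt
      by_contra hne
      have := Finset.le_sup (f := fun m : Fin 2 →₀ ℕ => 2 * m 0 + 3 * m 1) (mem_support_iff.2 hne)
      simp only [planeExponent_apply_zero, planeExponent_apply_one] at this
      omega
  have hfC : f = C (coeff 0 f) := by
    ext m
    rw [coeff_C]
    split_ifs with hm
    · rw [hm]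
    · rw [← planeExponent_eq m]
      refine hvanish _ _ (Nat.pos_of_ne_zero fun h => hm ?_)
      ext i
      fin_cases i <;> simp <;> omega
  refine ⟨⟨_, hfC⟩, ?_⟩
  rw [hfC, derivation_C] at hf
  have hc := congrArg (coeff 0) hf
  have ha := congrArg (coeff (Finsupp.single 1 1)) hf
  simp only [algebraMap_eq, coeff_zero, coeff_add, coeff_C, coeff_smul, coeff_X, smul_eq_mul]
    at hc ha
  have hne : (0 : Fin 2 →₀ ℕ) ≠ Finsupp.single 1 1 := fun h => by
    simpa using DFunLike.congr_fun h 1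
  exact ⟨by simpa [hne.symm] using hc.symm, by simpa [hne] using ha.symm⟩

end PlaneCoefficients

lemma spanAvoidsRange_jordan {k : Type*} [Field k] [CharZero k] (m : ℕ) :
    ∀ (D : Derivation k (MvPolynomial (Fin (m + 2)) k) (MvPolynomial (Fin (m + 2)) k)),
      D (X 0) = 1 - X 0 * X 1 → D (X 1) = X 0 ^ 3 →
      (∀ (i : ℕ) (hi : i + 2 < m + 2), D (X ⟨i + 2, hi⟩) = X ⟨i + 1, by omega⟩) →
      SpanAvoidsRange D (X (Fin.last (m + 1))) := by
  induction m with
  | zero => exact fun D h0 h1 _ => spanAvoidsRange_plane h0 h1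
  | succ m ih =>
    intro D h0 h1 hi
    set e : MvPolynomial (Fin (m + 3)) k ≃ₐ[k] Polynomial (MvPolynomial (Fin (m + 2)) k) :=
      (renameEquiv k finSuccEquivLast).trans (optionEquivLeft k (Fin (m + 2)))
    have he_last : e (X (Fin.last (m + 2))) = Polynomial.X := by simp [e]
    have he : ∀ i, e (X (Fin.castSucc i)) = Polynomial.C (X i) := by intro i; simp [e]
    have he0 : e (X 0) = Polynomial.C (X 0) := he 0
    have he1 : e (X 1) = Polynomial.C (X 1) := he 1
    have hD0 : e (D (X 0)) = Polynomial.C (1 - X 0 * X 1) := by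
      simp [h0, he0, he1]
    have hD1 : e (D (X 1)) = Polynomial.C (X 0 ^ 3) := by
      simp [h1, he0]
    have hDi : ∀ (i : ℕ) (hi : i + 2 < m + 3),
        e (D (X ⟨i + 2, hi⟩)) = Polynomial.C (X ⟨i + 1, by omega⟩) := by
      intro i hi'
      rw [hi, ← he]
      rfl
    have hΔ : ∀ i, ∃ g, D.conjAlgEquiv e (Polynomial.C (X i)) = Polynomial.C g := by
      intro i
      rw [← he, D.conjAlgEquiv_apply]
      obtain ⟨_ | _ | i, hi'⟩ := i
      · exact ⟨_, hD0⟩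
      · exact ⟨_, hD1⟩
      · exact ⟨_, hDi i (by omega)⟩
    choose g hg using hΔ
    have hC : ∀ r, D.conjAlgEquiv e (Polynomial.C r) = Polynomial.C (mkDerivation k g r) := by
      intro r
      induction r using MvPolynomial.induction_on with
      | C a =>
        rw [derivation_C, map_zero, ← algebraMap_eq, ← Polynomial.algebraMap_apply,
          Derivation.map_algebraMap]
      | add p q hp hq => simp only [map_add, hp, hq]
      | mul_X p i hp =>
        rw [map_mul, Derivation.leibniz, hp, hg, Derivation.leibniz, mkDerivation_X]
        simp only [smul_eq_mul, map_add, map_mul]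
    have hval : ∀ i p, e (D (X i.castSucc)) = Polynomial.C p → mkDerivation k g (X i) = p := by
      intro i p hp
      apply Polynomial.C_injective
      rw [← hC, ← he, D.conjAlgEquiv_apply, hp]
    refine .of_conjAlgEquiv e ?_
    rw [he_last]
    refine (ih (mkDerivation k g) (hval 0 _ hD0) (hval 1 _ hD1) fun i hi' =>
      hval ⟨i + 2, hi'⟩ _ (hDi i (by omega))).polynomial _ hC ?_
    rw [← he_last, D.conjAlgEquiv_apply]
    exact hDi m (by omega)

/-- for the Jordan derivation
`Dₙ = (1 − x₁x₂) ∂/∂x₁ + x₁³ ∂/∂x₂ + Σ_{i≥3} x_{i-1} ∂/∂x_i` of `k[x₁,…,xₙ]`, `n ≥ 2`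
(0-indexed: `x₁ = X 0`, etc.), we have `Im(Dₙ) ∩ k = 0`; in particular there is no `s`
with `Dₙ s = 1`. -/
theorem stmt16 {k : Type} [Field k] [CharZero k] [IsAlgClosed k] {n : ℕ} (hn : 2 ≤ n)
    (D : Derivation k (MvPolynomial (Fin n) k) (MvPolynomial (Fin n) k))
    (hD1 : D (X ⟨0, by omega⟩) = 1 - X ⟨0, by omega⟩ * X ⟨1, by omega⟩)
    (hD2 : D (X ⟨1, by omega⟩) = X ⟨0, by omega⟩ ^ 3)
    (hDi : ∀ i : Fin n, 2 ≤ (i : ℕ) →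
      D (X i) = X ⟨(i : ℕ) - 1, lt_of_le_of_lt (Nat.sub_le _ _) i.isLt⟩) :
    (∀ (f : MvPolynomial (Fin n) k) (c : k), D f = C c → c = 0) ∧
    ¬ ∃ s : MvPolynomial (Fin n) k, D s = 1 := by
  obtain ⟨m, rfl⟩ := Nat.exists_eq_add_of_le' hn
  have h := spanAvoidsRange_jordan m D hD1 hD2 fun i hi => hDi ⟨i + 2, hi⟩ (by simp)
  have hmain : ∀ (f : MvPolynomial (Fin (m + 2)) k) (c : k), D f = C c → c = 0 := fun f c hf =>
    (h f c 0 (by rw [hf, zero_smul, add_zero, algebraMap_eq])).2.1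
  exact ⟨hmain, fun ⟨s, hs⟩ => one_ne_zero (hmain s 1 (by rw [hs, C_1]))⟩
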